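/- Let m,n,p ≥ 3 and let D be the DFA over alphabet {a,b} with state set {0,…,m−1}×{0,…,n−1}×{0,…,p−1}, where letter a sends (i,j,k) to (i+1 mod m, j+1 mod n, k) and letter b sends (i,j,k) to (i, τ(j), k+1 mod p), τ being the transposition exchanging 0 and 1 and fixing all other elements of {0,…,n−1}. Then for any two states s = (i_s,j_s,k_s) and s' = (i_d,j_d,k_d) of D there exists a word w ∈ {a,b}* such that s·w = s'. -/

import Mathlib

/-- The cyclic permutation `i ↦ i+1 mod n` on `{0,…,n−1}`. -/
def cyc {n : ℕ} (i : Fin n) : Fin n := ⟨(i.val + 1) % n, Nat.mod_lt _ i.pos⟩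

/-- The transposition exchanging `0` and `1` and fixing all other elements of `{0,…,n−1}`. -/
def transp {n : ℕ} (i : Fin n) : Fin n :=
  if i.val = 0 then ⟨1 % n, Nat.mod_lt _ i.pos⟩
  else if i.val = 1 then ⟨0, i.pos⟩ else i

/-- The contraction sending `1` to `0` and fixing all other elements of `{0,…,n−1}`. -/
def contr {n : ℕ} (i : Fin n) : Fin n := if i.val = 1 then ⟨0, i.pos⟩ else i

/-- A Brzozowski-type complete DFA: state set `{0,…,n−1}`, initial state `0`,
unique final state `n−1`, where each letter `x` acts as the transformation `f x`. -/
def brzDFA {α : Type} (n : ℕ) (hn : 0 < n) (f : α → Fin n → Fin n) : DFA α (Fin n) where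
  step q x := f x q
  start := ⟨0, hn⟩
  accept := {⟨n - 1, Nat.sub_lt hn Nat.one_pos⟩}

/-- The two-letter alphabet `{a,b}`. -/
inductive Two | a | b

/-- The transition function of the product DFA `D` of `X_m(a,−,−;{b})`,
`X_n(a,b,−;∅)` and `X_p(b,−,−;{a}})`. -/
def Dstep (m n p : ℕ) : (Fin m × Fin n × Fin p) → Two → (Fin m × Fin n × Fin p)
  | (i, j, k), Two.a => (cyc i, cyc j, k)
  | (i, j, k), Two.b => (i, transp j, cyc k)

theorem cyc_injective {n : ℕ} : Function.Injective (cyc (n := n)) := by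
  intro i j h
  have h' : i.val + 1 ≡ j.val + 1 [MOD n] := congrArg Fin.val h
  exact Fin.ext ((Nat.ModEq.add_right_cancel' 1 h').eq_of_lt_of_lt i.isLt j.isLt)

theorem cyc_surjective {n : ℕ} : Function.Surjective (cyc (n := n)) :=
  Finite.surjective_of_injective cyc_injective

theorem cyc_mk {n i : ℕ} (h : i + 1 < n) :
    cyc (⟨i, Nat.lt_of_succ_lt h⟩ : Fin n) = ⟨i + 1, h⟩ :=
  Fin.ext (Nat.mod_eq_of_lt h)

/-- Induction along the cycle `cyc`, starting at `0`. -/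
theorem cyc_induction {n : ℕ} (hn : 0 < n) {P : Fin n → Prop} (zero : P ⟨0, hn⟩)
    (step : ∀ i, P i → P (cyc i)) (i : Fin n) : P i := by
  obtain ⟨i, hi⟩ := i
  induction i with
  | zero => exact zero
  | succ i ih => exact cyc_mk hi ▸ step _ (ih (Nat.lt_of_succ_lt hi))

theorem transp_involutive {n : ℕ} (hn : 2 ≤ n) : Function.Involutive (transp (n := n)) := by
  intro i
  have h1 : 1 % n = 1 := Nat.mod_eq_of_lt hn
  unfold transp
  split_ifs <;> simp_all [Fin.ext_iff]

theorem Dstep_injective {m n p : ℕ} (hn : 2 ≤ n) (x : Two) :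
    Function.Injective fun s => Dstep m n p s x := by
  rintro ⟨i, j, k⟩ ⟨i', j', k'⟩ h
  cases x <;>
    simpa [Dstep, cyc_injective.eq_iff, (transp_involutive hn).injective.eq_iff] using h

/-- The state `t` is reachable from the state `s` in the automaton `D`. -/
def Reach (m n p : ℕ) (s t : Fin m × Fin n × Fin p) : Prop :=
  ∃ w : List Two, w.foldl (Dstep m n p) s = t

namespace Reach

variable {m n p : ℕ} {s t u : Fin m × Fin n × Fin p}

theorem refl (s : Fin m × Fin n × Fin p) : Reach m n p s s := ⟨[], rfl⟩

theorem trans (h : Reach m n p s t) (h' : Reach m n p t u) : Reach m n p s u := by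
  obtain ⟨v, rfl⟩ := h
  obtain ⟨w, rfl⟩ := h'
  exact ⟨v ++ w, List.foldl_append⟩

theorem step (s : Fin m × Fin n × Fin p) (x : Two) : Reach m n p s (Dstep m n p s x) :=
  ⟨[x], rfl⟩

theorem iterate (s : Fin m × Fin n × Fin p) (x : Two) (r : ℕ) :
    Reach m n p s ((fun s => Dstep m n p s x)^[r] s) := by
  induction r with
  | zero => exact refl s
  | succ r ih =>
    rw [Function.iterate_succ_apply']
    exact ih.trans (step _ x)

theorem step_back (hn : 2 ≤ n) (s : Fin m × Fin n × Fin p) (x : Two) :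
    Reach m n p (Dstep m n p s x) s := by
  obtain ⟨r, hr, h⟩ := (Dstep_injective (m := m) (p := p) hn x).mem_periodicPts s
  obtain ⟨r, rfl⟩ := Nat.exists_eq_succ_of_ne_zero hr.ne'
  have hreach := iterate (Dstep m n p s x) x r
  rwa [← Function.iterate_succ_apply (fun s => Dstep m n p s x), h.eq] at hreach

theorem symm (hn : 2 ≤ n) (h : Reach m n p s t) : Reach m n p t s := by
  obtain ⟨w, rfl⟩ := h
  induction w generalizing s with
  | nil => exact refl s
  | cons x w ih => exact ih.trans (step_back hn s x)

theorem step_a (i : Fin m) (j : Fin n) (k : Fin p) :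
    Reach m n p (i, j, k) (cyc i, cyc j, k) := step (i, j, k) Two.a

theorem step_b (i : Fin m) (j : Fin n) (k : Fin p) :
    Reach m n p (i, j, k) (i, transp j, cyc k) := step (i, j, k) Two.b

theorem cyc_snd (hn : 3 ≤ n) (i : Fin m) (j : Fin n) (k : Fin p) :
    Reach m n p (i, j, k) (i, cyc j, k) := by
  have hn2 : 2 ≤ n := by omega
  have h0 : 0 < n := by omega
  induction j using cyc_induction h0 generalizing i k with
  | zero =>
    have hc : cyc (⟨0, h0⟩ : Fin n) = ⟨1, hn2⟩ := cyc_mk hn2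
    have hc' : cyc (⟨1, hn2⟩ : Fin n) = ⟨2, hn⟩ := cyc_mk hn
    have ht : transp (⟨0, h0⟩ : Fin n) = ⟨1, hn2⟩ := Fin.ext (Nat.mod_eq_of_lt hn2)
    have ht' : transp (⟨2, hn⟩ : Fin n) = ⟨2, hn⟩ := by simp [transp]
    have hb := step_b i ⟨0, h0⟩ k
    have ha := step_a i ⟨1, hn2⟩ (cyc k)
    have hb' := step_b (cyc i) ⟨2, hn⟩ k
    have ha' := step_a i ⟨1, hn2⟩ k
    rw [ht] at hb
    rw [hc'] at ha ha'
    rw [ht'] at hb'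
    rw [hc]
    exact hb.trans (ha.trans ((hb'.symm hn2).trans (ha'.symm hn2)))
  | step j ih =>
    obtain ⟨i, rfl⟩ := cyc_surjective i
    exact ((step_a i j k).symm hn2).trans ((ih i k).trans (step_a i (cyc j) k))

theorem snd (hn : 3 ≤ n) (i : Fin m) (j j' : Fin n) (k : Fin p) :
    Reach m n p (i, j, k) (i, j', k) := by
  have h0 : 0 < n := by omega
  have h (j : Fin n) : Reach m n p (i, ⟨0, h0⟩, k) (i, j, k) := by
    induction j using cyc_induction h0 with
    | zero => exact refl _
    | step j ih => exact ih.trans (cyc_snd hn i j k)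
  exact ((h j).symm (by omega)).trans (h j')

theorem of_zero (hm : 0 < m) (hn : 3 ≤ n) (hp : 0 < p) (s : Fin m × Fin n × Fin p) :
    Reach m n p (⟨0, hm⟩, ⟨0, by omega⟩, ⟨0, hp⟩) s := by
  obtain ⟨i, j, k⟩ := s
  induction i using cyc_induction hm generalizing j with
  | zero =>
    induction k using cyc_induction hp generalizing j with
    | zero => exact snd hn _ _ _ _
    | step k ih => exact (ih j).trans ((step_b _ j k).trans (snd hn _ _ _ _))
  | step i ih => exact (ih j).trans ((step_a i j k).trans (snd hn _ _ _ _))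

end Reach

theorem statement2 (m n p : ℕ) (hm : 3 ≤ m) (hn : 3 ≤ n) (hp : 3 ≤ p)
    (s s' : Fin m × Fin n × Fin p) :
    ∃ w : List Two, w.foldl (Dstep m n p) s = s' :=
  ((Reach.of_zero (by omega) hn (by omega) s).symm (by omega)).trans
    (Reach.of_zero (by omega) hn (by omega) s')
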